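/- arXiv:2106.13898 — 6 statements merged into one kernel-verified Lean document; each statement's English description precedes it below -/
import Mathlib

section
/- Let w_τ > 0, A, x₀ ∈ ℝ and set c = x₀ - A. Let f : ℝ → ℝ satisfy 0 ≤ f(u) ≤ 1 for all u, and let I : ℝ → ℝ be continuous. Define x(t) = c·exp(−w_τ·t − ∫₀ᵗ f(I(s)) ds) + A and x̃(t) = c·exp(−(w_τ + f(I(t)))·t)·f(−I(t)) + A. Then for every t ≥ 0, |x(t) − x̃(t)| ≤ |c|·exp(−w_τ·t). -/
/-- error bound between the exact LTC solution and the
approximate closed-form solution. -/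
theorem ltc_closed_form_error_bound
    (wτ A x₀ : ℝ) (hw : 0 < wτ) (c : ℝ) (hc : c = x₀ - A)
    (f : ℝ → ℝ) (hf : ∀ u, 0 ≤ f u ∧ f u ≤ 1)
    (I : ℝ → ℝ) (hI : Continuous I)
    (x xa : ℝ → ℝ)
    (hx : ∀ t, x t = c * Real.exp (-wτ * t - ∫ s in (0:ℝ)..t, f (I s)) + A)
    (hxa : ∀ t, xa t = c * Real.exp (-(wτ + f (I t)) * t) * f (-I t) + A) :
    ∀ t, 0 ≤ t → |x t - xa t| ≤ |c| * Real.exp (-wτ * t) := by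
  intro t ht
  have hJ : 0 ≤ ∫ s in (0:ℝ)..t, f (I s) :=
    intervalIntegral.integral_nonneg ht (fun s _ => (hf (I s)).1)
  rw [hx, hxa]
  generalize (∫ s in (0:ℝ)..t, f (I s)) = J at hJ
  have e : c * Real.exp (-wτ * t - J) + A
      - (c * Real.exp (-(wτ + f (I t)) * t) * f (-I t) + A)
      = c * Real.exp (-wτ * t) * (Real.exp (-J) - Real.exp (-(f (I t) * t)) * f (-I t)) := by
    have h1 : Real.exp (-wτ * t - J) = Real.exp (-wτ * t) * Real.exp (-J) := by
      rw [← Real.exp_add]; ring_nf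
    have h2 : Real.exp (-(wτ + f (I t)) * t)
        = Real.exp (-wτ * t) * Real.exp (-(f (I t) * t)) := by
      rw [← Real.exp_add]; ring_nf
    rw [h1, h2]; ring
  have a1 : Real.exp (-J) ≤ 1 := Real.exp_le_one_iff.2 (by linarith)
  have a0 := Real.exp_pos (-J)
  have b1 : Real.exp (-(f (I t) * t)) ≤ 1 :=
    Real.exp_le_one_iff.2 (by have := mul_nonneg (hf (I t)).1 ht; linarith)
  have b0 := Real.exp_pos (-(f (I t) * t))
  have p0 := mul_nonneg b0.le (hf (-I t)).1
  have p1 := mul_le_one₀ b1 (hf (-I t)).1 (hf (-I t)).2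
  rw [e, abs_mul, abs_mul, abs_of_pos (Real.exp_pos _)]
  refine mul_le_of_le_one_right (by positivity) ?_
  rw [abs_le]
  constructor <;> linarith
end

section
/- Let f : ℝ → ℝ be Lipschitz continuous, monotonically increasing, with 0 ≤ f(u) ≤ 1 for all u, f(u) → 0 as u → −∞ and f(u) → 1 as u → +∞. Fix w_τ > 0 and t ≥ 0. Define, for a continuous signal I : [0,t] → ℝ, D(I) := exp(−∫₀ᵗ f(I(s)) ds) − exp(−f(I(t))·t)·f(−I(t)). Then exp(−w_τ·t) is the least upper bound of the set { exp(−w_τ·t)·D(I) : I continuous on [0,t] }; that is, exp(−w_τ t)·D(I) ≤ exp(−w_τ t) for every continuous I, and for every ε > 0 there is a continuous I with exp(−w_τ t)·D(I) > exp(−w_τ t) − ε. -/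
/-- sharpness of the upper bound — `exp(−wτ·t)` is the least upper
bound of `{ exp(−wτ·t)·D(I) : I continuous on [0,t] }`, where `D(I)` is the
normalized difference between the exact and approximate LTC solutions. -/
theorem ltc_approximation_sup_sharp
    (f : ℝ → ℝ) (L : NNReal) (hLip : LipschitzWith L f)
    (hmono : Monotone f) (hbound : ∀ u, 0 ≤ f u ∧ f u ≤ 1)
    (hbot : Filter.Tendsto f Filter.atBot (nhds 0))
    (htop : Filter.Tendsto f Filter.atTop (nhds 1))
    (wτ : ℝ) (hw : 0 < wτ) (t : ℝ) (ht : 0 ≤ t)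
    (D : (ℝ → ℝ) → ℝ)
    (hD : ∀ I : ℝ → ℝ, D I =
      Real.exp (-(∫ s in (0:ℝ)..t, f (I s))) -
        Real.exp (-(f (I t) * t)) * f (-I t)) :
    (∀ I : ℝ → ℝ, ContinuousOn I (Set.Icc 0 t) →
        Real.exp (-wτ * t) * D I ≤ Real.exp (-wτ * t)) ∧
    (∀ ε > (0:ℝ), ∃ I : ℝ → ℝ, ContinuousOn I (Set.Icc 0 t) ∧
        Real.exp (-wτ * t) * D I > Real.exp (-wτ * t) - ε) := by
  have e0 := Real.exp_pos (-wτ * t)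
  have hcf := hLip.continuous
  constructor
  · intro I _
    have h1 : 0 ≤ ∫ s in (0:ℝ)..t, f (I s) :=
      intervalIntegral.integral_nonneg ht (fun u _ => (hbound _).1)
    have h2 : Real.exp (-(∫ s in (0:ℝ)..t, f (I s))) ≤ 1 :=
      Real.exp_le_one_iff.mpr (by linarith)
    have h3 : 0 ≤ Real.exp (-(f (I t) * t)) * f (-I t) :=
      mul_nonneg (Real.exp_pos _).le (hbound _).1
    have h4 : D I ≤ 1 := by rw [hD]; linarith
    nlinarith
  · intro ε hε
    have hint : Filter.Tendsto
        (fun n : ℕ => ∫ s in (0:ℝ)..t, f ((n:ℝ) * (1 + (n:ℝ) * (s - t))))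
        Filter.atTop (nhds (∫ _s in (0:ℝ)..t, (0:ℝ))) := by
      apply intervalIntegral.tendsto_integral_filter_of_dominated_convergence (fun _ => (1:ℝ))
      · refine Filter.Eventually.of_forall fun n => Continuous.aestronglyMeasurable ?_
        fun_prop
      · refine Filter.Eventually.of_forall fun n => Filter.Eventually.of_forall fun s _ => ?_
        rw [Real.norm_eq_abs, abs_of_nonneg (hbound _).1]
        exact (hbound _).2
      · exact intervalIntegrable_const
      · have hne : ∀ᵐ s : ℝ, s ≠ t := by
          simp [MeasureTheory.ae_iff]
        filter_upwards [hne] with s hs hmem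
        rw [Set.uIoc_of_le ht] at hmem
        have hlt : s - t < 0 := sub_neg.mpr (lt_of_le_of_ne hmem.2 hs)
        have hn := tendsto_natCast_atTop_atTop (R := ℝ)
        have h1 : Filter.Tendsto (fun n : ℕ => 1 + (n:ℝ) * (s - t)) Filter.atTop Filter.atBot :=
          Filter.tendsto_atBot_add_const_left _ _ (hn.atTop_mul_const_of_neg hlt)
        exact hbot.comp (hn.atTop_mul_atBot₀ h1)
    rw [intervalIntegral.integral_zero] at hint
    have hf : Filter.Tendsto (fun n : ℕ => f (-(n:ℝ))) Filter.atTop (nhds 0) :=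
      hbot.comp (Filter.tendsto_neg_atTop_atBot.comp tendsto_natCast_atTop_atTop)
    have hlim : Filter.Tendsto (fun n : ℕ => Real.exp (-wτ * t) *
        (Real.exp (-(∫ s in (0:ℝ)..t, f ((n:ℝ) * (1 + (n:ℝ) * (s - t))))) - f (-(n:ℝ))))
        Filter.atTop (nhds (Real.exp (-wτ * t))) := by
      have := (((Real.continuous_exp.tendsto _).comp hint.neg).sub hf).const_mul
        (Real.exp (-wτ * t))
      simpa using this
    obtain ⟨n, hn⟩ := (hlim.eventually (lt_mem_nhds (sub_lt_self _ hε))).exists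
    refine ⟨fun s => (n:ℝ) * (1 + (n:ℝ) * (s - t)), by fun_prop, ?_⟩
    refine lt_of_lt_of_le hn (mul_le_mul_of_nonneg_left ?_ e0.le)
    rw [hD]
    simp only [sub_self, mul_zero, add_zero, mul_one]
    have h2 : Real.exp (-(f (n:ℝ) * t)) ≤ 1 :=
      Real.exp_le_one_iff.mpr (by have := mul_nonneg (hbound (n:ℝ)).1 ht; linarith)
    have := mul_le_of_le_one_left (hbound (-(n:ℝ))).1 h2
    linarith
end

section
/- Let f : ℝ → ℝ be Lipschitz continuous, monotonically increasing, with 0 ≤ f(u) ≤ 1 for all u, f(u) → 0 as u → −∞ and f(u) → 1 as u → +∞. Fix w_τ > 0 and t ≥ 0. Define, for a continuous signal I : [0,t] → ℝ, D(I) := exp(−∫₀ᵗ f(I(s)) ds) − exp(−f(I(t))·t)·f(−I(t)). Then exp(−w_τ·t)·(exp(−t) − 1) is the greatest lower bound of the set { exp(−w_τ·t)·D(I) : I continuous on [0,t] }; that is, exp(−w_τ t)·D(I) ≥ exp(−w_τ t)·(exp(−t) − 1) for every continuous I, and for every ε > 0 there is a continuous I with exp(−w_τ t)·D(I) < exp(−w_τ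 t)·(exp(−t) − 1) + ε. -/
/-- sharpness of the lower bound — `exp(−wτ·t)·(exp(−t) − 1)` is
the greatest lower bound of `{ exp(−wτ·t)·D(I) : I continuous on [0,t] }`,
where `D(I)` is the normalized difference between the exact and approximate
LTC solutions. -/
theorem ltc_approximation_inf_sharp
    (f : ℝ → ℝ) (L : NNReal) (hLip : LipschitzWith L f)
    (hmono : Monotone f) (hbound : ∀ u, 0 ≤ f u ∧ f u ≤ 1)
    (hbot : Filter.Tendsto f Filter.atBot (nhds 0))
    (htop : Filter.Tendsto f Filter.atTop (nhds 1))
    (wτ : ℝ) (hw : 0 < wτ) (t : ℝ) (ht : 0 ≤ t)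
    (D : (ℝ → ℝ) → ℝ)
    (hD : ∀ I : ℝ → ℝ, D I =
      Real.exp (-(∫ s in (0:ℝ)..t, f (I s))) -
        Real.exp (-(f (I t) * t)) * f (-I t)) :
    (∀ I : ℝ → ℝ, ContinuousOn I (Set.Icc 0 t) →
        Real.exp (-wτ * t) * D I ≥ Real.exp (-wτ * t) * (Real.exp (-t) - 1)) ∧
    (∀ ε > (0:ℝ), ∃ I : ℝ → ℝ, ContinuousOn I (Set.Icc 0 t) ∧
        Real.exp (-wτ * t) * D I
          < Real.exp (-wτ * t) * (Real.exp (-t) - 1) + ε) := by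
  have hc : Continuous f := hLip.continuous
  constructor
  · intro I hI
    have hint : IntervalIntegrable (fun s => f (I s)) MeasureTheory.volume 0 t := by
      apply ContinuousOn.intervalIntegrable
      rw [Set.uIcc_of_le ht]
      exact hc.comp_continuousOn hI
    have h1 : (∫ s in (0:ℝ)..t, f (I s)) ≤ t := by
      have := intervalIntegral.integral_mono_on ht hint
        (intervalIntegrable_const (c := (1:ℝ))) (fun x _ => (hbound (I x)).2)
      simpa using this
    have h2 : Real.exp (-t) ≤ Real.exp (-(∫ s in (0:ℝ)..t, f (I s))) :=
      Real.exp_le_exp.mpr (by linarith)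
    have h3 : Real.exp (-(f (I t) * t)) ≤ 1 := by
      rw [Real.exp_le_one_iff]
      have := mul_nonneg (hbound (I t)).1 ht
      linarith
    have h4 : Real.exp (-(f (I t) * t)) * f (-I t) ≤ 1 :=
      mul_le_one₀ h3 (hbound _).1 (hbound _).2
    apply mul_le_mul_of_nonneg_left _ (Real.exp_pos _).le
    rw [hD]
    linarith
  · intro ε hε
    let J : ℕ → ℝ → ℝ := fun n s => (n:ℝ) * ((n:ℝ) * (t - s) - 1)
    have hJc : ∀ n, Continuous (J n) := fun n => by
      show Continuous fun s => (n:ℝ) * ((n:ℝ) * (t - s) - 1)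
      fun_prop
    have hn : Filter.Tendsto (fun n : ℕ => (n:ℝ)) Filter.atTop Filter.atTop :=
      tendsto_natCast_atTop_atTop
    have hJt : ∀ n, J n t = -(n:ℝ) := fun n => by simp [J]
    have hint : Filter.Tendsto (fun n => ∫ s in (0:ℝ)..t, f (J n s)) Filter.atTop
        (nhds (∫ s in (0:ℝ)..t, (1:ℝ))) := by
      apply intervalIntegral.tendsto_integral_filter_of_dominated_convergence (fun _ => (1:ℝ))
      · exact Filter.Eventually.of_forall fun n =>
          (hc.comp (hJc n)).aestronglyMeasurable
      · refine Filter.Eventually.of_forall fun n => Filter.Eventually.of_forall fun s _ => ?_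
        rw [Real.norm_eq_abs, abs_of_nonneg (hbound _).1]
        exact (hbound _).2
      · exact intervalIntegrable_const
      · have hne : ∀ᵐ s : ℝ, s ≠ t := by
          simp [MeasureTheory.ae_iff]
        filter_upwards [hne] with s hs hmem
        rw [Set.uIoc_of_le ht] at hmem
        have hlt : 0 < t - s := sub_pos.mpr (lt_of_le_of_ne hmem.2 hs)
        apply htop.comp
        apply hn.atTop_mul_atTop₀
        exact Filter.tendsto_atTop_add_const_right _ (-1) (hn.atTop_mul_const hlt)
    have h0 : Filter.Tendsto (fun n => f (J n t)) Filter.atTop (nhds 0) := by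
      simp only [hJt]
      exact hbot.comp (Filter.tendsto_neg_atTop_atBot.comp hn)
    have h1 : Filter.Tendsto (fun n => f (-J n t)) Filter.atTop (nhds 1) := by
      simp only [hJt, neg_neg]
      exact htop.comp hn
    have hlim : Filter.Tendsto (fun n => Real.exp (-wτ * t) * D (J n)) Filter.atTop
        (nhds (Real.exp (-wτ * t) * (Real.exp (-t) - 1))) := by
      simp only [hD]
      have hE : Filter.Tendsto Real.exp (nhds (-(0 * t))) (nhds (Real.exp (-(0 * t)))) :=
        Real.continuous_exp.tendsto _
      have hE' := Real.continuous_exp.tendsto (-(∫ s in (0:ℝ)..t, (1:ℝ)))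
      have := (((hE'.comp hint.neg).sub
        ((hE.comp (h0.mul_const t).neg).mul h1)).const_mul (Real.exp (-wτ * t)))
      simpa using this
    obtain ⟨n, hn'⟩ := (hlim.eventually (gt_mem_nhds (lt_add_of_pos_right _ hε))).exists
    exact ⟨J n, (hJc n).continuousOn, hn'⟩
end

section
/- Let f : ℝ → ℝ satisfy 0 ≤ f(u) ≤ 1 for all u, let t > 0, ε > 0, 0 < δ < t, and let C > 0 be such that f(−C) ≤ ε and f(C) ≥ 1 − ε. Let I : [0,t] → ℝ be the piecewise constant signal with I(s) = −C for s ∈ [0, t−δ] and I(s) = C for s ∈ (t−δ, t]. Then exp(−∫₀ᵗ f(I(s)) ds) − exp(−f(I(t))·t)·f(−I(t)) ≥ exp(−ε·t − δ) − exp(−(1−ε)·t)·ε. -/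
/-- lower bound on the normalized difference `D(I)` for the
two-level piecewise constant witness signal, used in the supremum sharpness
claim. -/
theorem ltc_witness_signal_lower_bound
    (f : ℝ → ℝ) (hf : ∀ u, 0 ≤ f u ∧ f u ≤ 1)
    (t ε δ C : ℝ) (ht : 0 < t) (hε : 0 < ε) (hδ0 : 0 < δ) (hδt : δ < t)
    (hC : 0 < C) (hfC1 : f (-C) ≤ ε) (hfC2 : 1 - ε ≤ f C)
    (I : ℝ → ℝ)
    (hI1 : ∀ s, 0 ≤ s → s ≤ t - δ → I s = -C)
    (hI2 : ∀ s, t - δ < s → s ≤ t → I s = C) :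
    Real.exp (-(∫ s in (0:ℝ)..t, f (I s))) -
        Real.exp (-(f (I t) * t)) * f (-I t)
      ≥ Real.exp (-ε * t - δ) - Real.exp (-(1 - ε) * t) * ε := by
  have hIt : I t = C := hI2 t (by linarith) le_rfl
  have e1 : Set.EqOn (fun _ : ℝ => f (-C)) (fun s => f (I s)) (Set.uIoc 0 (t - δ)) := by
    intro s hs
    rw [Set.uIoc_of_le (by linarith)] at hs
    simp only [hI1 s hs.1.le hs.2]
  have e2 : Set.EqOn (fun _ : ℝ => f C) (fun s => f (I s)) (Set.uIoc (t - δ) t) := by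
    intro s hs
    rw [Set.uIoc_of_le (by linarith)] at hs
    simp only [hI2 s hs.1 hs.2]
  have i1 : IntervalIntegrable (fun s => f (I s)) MeasureTheory.volume 0 (t - δ) :=
    (intervalIntegrable_const (c := f (-C))).congr e1
  have i2 : IntervalIntegrable (fun s => f (I s)) MeasureTheory.volume (t - δ) t :=
    (intervalIntegrable_const (c := f C)).congr e2
  have hint : ∫ s in (0:ℝ)..t, f (I s) = (t - δ) * f (-C) + δ * f C := by
    rw [← intervalIntegral.integral_add_adjacent_intervals i1 i2,
      ← intervalIntegral.integral_congr_ae (Filter.Eventually.of_forall e1),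
      ← intervalIntegral.integral_congr_ae (Filter.Eventually.of_forall e2)]
    simp
  rw [hint, hIt]
  have h1 : Real.exp (-ε * t - δ) ≤ Real.exp (-((t - δ) * f (-C) + δ * f C)) := by
    apply Real.exp_le_exp.2
    nlinarith [mul_le_mul_of_nonneg_left hfC1 (by linarith : 0 ≤ t - δ),
      mul_le_mul_of_nonneg_left (hf C).2 hδ0.le, mul_pos hε hδ0]
  have h2 : Real.exp (-(f C * t)) * f (-C) ≤ Real.exp (-(1 - ε) * t) * ε := by
    apply mul_le_mul _ hfC1 (hf _).1 (Real.exp_pos _).le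
    apply Real.exp_le_exp.2
    nlinarith [mul_le_mul_of_nonneg_right hfC2 ht.le]
  linarith
end

section
/- Let f : ℝ → ℝ satisfy 0 ≤ f(u) ≤ 1 for all u, let t > 0, ε > 0, 0 < δ < t, and let C > 0 be such that f(−C) ≤ ε and f(C) ≥ 1 − ε. Let I : [0,t] → ℝ be the piecewise constant signal with I(s) = −C for s ∈ [0, t−δ] and I(s) = C for s ∈ (t−δ, t], and consider its negation −I. Then exp(−∫₀ᵗ f(−I(s)) ds) − exp(−f(−I(t))·t)·f(I(t)) ≤ exp(−(1−ε)·(t−δ)) − exp(−ε·t)·(1−ε). -/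
/-- upper bound on the normalized difference `D(−I)` for the
negated two-level piecewise constant witness signal, used in the infimum
sharpness claim. -/
theorem ltc_negated_witness_signal_upper_bound
    (f : ℝ → ℝ) (hf : ∀ u, 0 ≤ f u ∧ f u ≤ 1)
    (t ε δ C : ℝ) (ht : 0 < t) (hε : 0 < ε) (hδ0 : 0 < δ) (hδt : δ < t)
    (hC : 0 < C) (hfC1 : f (-C) ≤ ε) (hfC2 : 1 - ε ≤ f C)
    (I : ℝ → ℝ)
    (hI1 : ∀ s, 0 ≤ s → s ≤ t - δ → I s = -C)
    (hI2 : ∀ s, t - δ < s → s ≤ t → I s = C) :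
    Real.exp (-(∫ s in (0:ℝ)..t, f (-I s))) -
        Real.exp (-(f (-I t) * t)) * f (I t)
      ≤ Real.exp (-(1 - ε) * (t - δ)) - Real.exp (-ε * t) * (1 - ε) := by
  have hIt : I t = C := hI2 t (by linarith) le_rfl
  have e1 : Set.EqOn (fun _ : ℝ => f C) (fun s => f (-I s)) (Set.uIoc 0 (t - δ)) := by
    intro s hs
    rw [Set.uIoc_of_le (by linarith)] at hs
    simp [hI1 s hs.1.le hs.2]
  have e2 : Set.EqOn (fun _ : ℝ => f (-C)) (fun s => f (-I s)) (Set.uIoc (t - δ) t) := by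
    intro s hs
    rw [Set.uIoc_of_le (by linarith)] at hs
    simp [hI2 s hs.1 hs.2]
  have i1 : IntervalIntegrable (fun s => f (-I s)) MeasureTheory.volume 0 (t - δ) :=
    (intervalIntegrable_const (c := f C)).congr e1
  have i2 : IntervalIntegrable (fun s => f (-I s)) MeasureTheory.volume (t - δ) t :=
    (intervalIntegrable_const (c := f (-C))).congr e2
  have v1 : ∫ s in (0:ℝ)..(t - δ), f (-I s) = (t - δ) * f C := by
    rw [← intervalIntegral.integral_congr_ae (Filter.Eventually.of_forall e1)]; simp
  have v2 : ∫ s in (t - δ)..t, f (-I s) = δ * f (-C) := by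
    rw [← intervalIntegral.integral_congr_ae (Filter.Eventually.of_forall e2)]; simp
  rw [← intervalIntegral.integral_add_adjacent_intervals i1 i2, v1, v2, hIt]
  have h1 : Real.exp (-((t - δ) * f C + δ * f (-C))) ≤ Real.exp (-(1 - ε) * (t - δ)) := by
    apply Real.exp_le_exp.mpr
    nlinarith [mul_nonneg hδ0.le (hf (-C)).1,
      mul_le_mul_of_nonneg_left hfC2 (sub_nonneg.mpr hδt.le)]
  have h2 : Real.exp (-ε * t) ≤ Real.exp (-(f (-C) * t)) := by
    apply Real.exp_le_exp.mpr
    nlinarith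
  have h3 := mul_le_mul_of_nonneg_right h2 (hf C).1
  have h4 := mul_le_mul_of_nonneg_left hfC2 (Real.exp_pos (-ε * t)).le
  linarith
end

section
/- Let w_τ > 0, A, x₀ ∈ ℝ with c = x₀ − A, let f : ℝ → ℝ satisfy 0 ≤ f(u) ≤ 1 for all u, and let I : ℝ → ℝ be continuous. Define x(t) = c·exp(−w_τ·t − ∫₀ᵗ f(I(s)) ds) + A and x̃(t) = c·exp(−(w_τ + f(I(t)))·t)·f(−I(t)) + A. Then |x(t) − x̃(t)| → 0 as t → ∞; more precisely, |x(t) − x̃(t)| ≤ |c|·exp(−w_τ·t), which tends to 0 exponentially fast. -/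
/-- the approximation error between the exact LTC solution and
the approximate closed-form solution tends to `0` as `t → ∞`; more precisely
it is bounded by `|c|·exp(−wτ·t)`, which tends to `0` (exponentially fast). -/
theorem ltc_error_tendsto_zero
    (wτ A x₀ : ℝ) (hw : 0 < wτ) (c : ℝ) (hc : c = x₀ - A)
    (f : ℝ → ℝ) (hf : ∀ u, 0 ≤ f u ∧ f u ≤ 1)
    (I : ℝ → ℝ) (hI : Continuous I)
    (x xa : ℝ → ℝ)
    (hx : ∀ t, x t = c * Real.exp (-wτ * t - ∫ s in (0:ℝ)..t, f (I s)) + A)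
    (hxa : ∀ t, xa t = c * Real.exp (-(wτ + f (I t)) * t) * f (-I t) + A) :
    Filter.Tendsto (fun t => |x t - xa t|) Filter.atTop (nhds 0) ∧
    (∀ t, 0 ≤ t → |x t - xa t| ≤ |c| * Real.exp (-wτ * t)) ∧
    Filter.Tendsto (fun t => |c| * Real.exp (-wτ * t)) Filter.atTop (nhds 0) := by
  have h3 : Filter.Tendsto (fun t => |c| * Real.exp (-wτ * t)) Filter.atTop (nhds 0) := by
    have h : Filter.Tendsto (fun t : ℝ => -wτ * t) Filter.atTop Filter.atBot :=
      Filter.tendsto_id.const_mul_atTop_of_neg (by linarith)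
    simpa using (Real.tendsto_exp_atBot.comp h).const_mul |c|
  have h2 : ∀ t, 0 ≤ t → |x t - xa t| ≤ |c| * Real.exp (-wτ * t) := by
    intro t ht
    have hint : 0 ≤ ∫ s in (0:ℝ)..t, f (I s) :=
      intervalIntegral.integral_nonneg ht (fun s _ => (hf (I s)).1)
    have e1 : Real.exp (-wτ * t - ∫ s in (0:ℝ)..t, f (I s)) ≤ Real.exp (-wτ * t) :=
      Real.exp_le_exp.2 (by linarith)
    have e2 : Real.exp (-(wτ + f (I t)) * t) ≤ Real.exp (-wτ * t) :=
      Real.exp_le_exp.2 (by nlinarith [mul_nonneg (hf (I t)).1 ht])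
    have p1 := Real.exp_pos (-wτ * t - ∫ s in (0:ℝ)..t, f (I s))
    have p2 := Real.exp_pos (-(wτ + f (I t)) * t)
    have q := hf (-I t)
    have e3 := mul_le_of_le_one_right p2.le q.2
    have e4 := mul_nonneg p2.le q.1
    have key : x t - xa t = c * (Real.exp (-wτ * t - ∫ s in (0:ℝ)..t, f (I s))
        - Real.exp (-(wτ + f (I t)) * t) * f (-I t)) := by
      rw [hx, hxa]; ring
    rw [key, abs_mul]
    exact mul_le_mul_of_nonneg_left (abs_le.2 ⟨by linarith, by linarith⟩) (abs_nonneg c)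
  refine ⟨?_, h2, h3⟩
  refine tendsto_of_tendsto_of_tendsto_of_le_of_le' tendsto_const_nhds h3
    (Filter.Eventually.of_forall fun t => abs_nonneg _) ?_
  filter_upwards [Filter.eventually_ge_atTop 0] with t ht using h2 t ht
end
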